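/- Let Γ be a countably infinite discrete group acting distally on a compact metrizable space X by homeomorphisms, and let μ be a Γ-invariant Borel probability measure on X. Then the naive measure entropy h^nv_μ(Γ↷X) is zero. -/

import Mathlib

open scoped ENNReal NNReal

/-- A finite Borel partition of `X`, encoded as a `Finset` of measurable, pairwise
disjoint sets whose union is `X`. -/
def IsFinBorelPartition {X : Type*} [MeasurableSpace X] (partn : Finset (Set X)) : Prop :=
  (∀ P ∈ partn, MeasurableSet P) ∧ ⋃₀ (partn : Set (Set X)) = Set.univ ∧
    ∀ P ∈ partn, ∀ Q ∈ partn, P ≠ Q → Disjoint P Q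

/-- `partn^F = ⋁_{s ∈ F} s⁻¹partn`: the join of the pullbacks of `partn` by the elements of `F`,
consisting of all intersections `⋂_{s ∈ F} s⁻¹ P_s` over choices `P_s ∈ partn`. -/
noncomputable def jointPartition {Γ : Type*} [Group Γ] {X : Type*} [MulAction Γ X]
    (F : Finset Γ) (partn : Finset (Set X)) : Finset (Set X) := by
  classical
  exact (F.pi fun _ => partn).image fun ω => ⋂ s : Γ, ⋂ h : s ∈ F, (fun x : X => s • x) ⁻¹' ω s h

/-- The Shannon entropy `H_μ(coll) = -∑_{Q ∈ coll} μ(Q) log μ(Q)` of a finite collection of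
sets with respect to the measure `μ`. -/
noncomputable def partitionShannonEntropy {X : Type*} [MeasurableSpace X]
    (μ : MeasureTheory.Measure X) (coll : Finset (Set X)) : ℝ :=
  ∑ Q ∈ coll, Real.negMulLog (μ Q).toReal

/-- The naive measure entropy
`h^nv_μ(Γ ↷ X) = sup_partn inf_F (1/|F|) H_μ(⋁_{s ∈ F} s⁻¹partn)`, where `partn` ranges over finite
Borel partitions of `X` and `F` over nonempty finite subsets of `Γ`. -/
noncomputable def naiveMeasureEntropy (Γ : Type*) {X : Type*} [Group Γ] [MeasurableSpace X]
    [MulAction Γ X] (μ : MeasureTheory.Measure X) : ℝ≥0∞ :=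
  ⨆ partn : {partn : Finset (Set X) // IsFinBorelPartition partn},
    ⨅ F : {F : Finset Γ // F.Nonempty},
      ENNReal.ofReal (partitionShannonEntropy μ (jointPartition F.1 partn.1) / (F.1.card : ℝ))

/-- The Gibbs inequality in the pointwise form `-p log p ≤ -p log q + q - p`. -/
theorem negMulLog_le_neg_mul_log_add_sub {p q : ℝ} (hp : 0 ≤ p) (hq : 0 ≤ q)
    (hpq : p ≠ 0 → q ≠ 0) : Real.negMulLog p ≤ -(p * Real.log q) + q - p := by
  rcases hp.eq_or_lt with rfl | hp
  · simpa using hq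
  · have hq : 0 < q := lt_of_le_of_ne hq (hpq hp.ne').symm
    have h := Real.log_le_sub_one_of_pos (div_pos hq hp)
    rw [Real.log_div hq.ne' hp.ne'] at h
    have h2 := mul_le_mul_of_nonneg_left h hp.le
    have h3 : p * (q / p - 1) = q - p := by field_simp
    rw [h3] at h2
    unfold Real.negMulLog
    linarith

/-- `x ↦ -x log x` is subadditive on finite families of nonnegative reals. -/
theorem negMulLog_sum_le {ι : Type*} (s : Finset ι) (a : ι → ℝ) (ha : ∀ i ∈ s, 0 ≤ a i) :
    Real.negMulLog (∑ i ∈ s, a i) ≤ ∑ i ∈ s, Real.negMulLog (a i) := by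
  have h : Real.negMulLog (∑ i ∈ s, a i) = ∑ i ∈ s, -(a i * Real.log (∑ j ∈ s, a j)) := by
    rw [Finset.sum_neg_distrib, ← Finset.sum_mul, Real.negMulLog]
    ring
  rw [h]
  refine Finset.sum_le_sum fun i hi => ?_
  rcases (ha i hi).eq_or_lt with h0 | h0
  · simp [← h0]
  · have h1 := Real.log_le_log h0 (Finset.single_le_sum ha hi)
    have h2 := mul_le_mul_of_nonneg_left h1 h0.le
    unfold Real.negMulLog
    linarith

/-- The atom of the Boolean algebra generated by the sets `B j` with membership pattern `σ`. -/
def boolAtom {J X : Type*} (B : J → Set X) (σ : J → Bool) : Set X :=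
  {x | ∀ j, x ∈ B j ↔ σ j = true}

theorem boolAtom_pairwiseDisjoint {J X : Type*} (B : J → Set X) (S : Set (J → Bool)) :
    S.PairwiseDisjoint (boolAtom B) := by
  intro σ _ τ _ hστ
  refine Set.disjoint_left.2 fun x hσ hτ => hστ (funext fun j => ?_)
  rw [Bool.eq_iff_iff, ← hσ j, hτ j]

theorem measurableSet_boolAtom {J X : Type*} [Finite J] [MeasurableSpace X] {B : J → Set X}
    (hB : ∀ j, MeasurableSet (B j)) (σ : J → Bool) : MeasurableSet (boolAtom B σ) := by
  have : boolAtom B σ = ⋂ j, if σ j = true then B j else (B j)ᶜ := by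
    ext x
    simp only [boolAtom, Set.mem_ofPred_eq, Set.mem_iInter]
    refine forall_congr' fun j => ?_
    cases σ j <;> simp
  rw [this]
  refine MeasurableSet.iInter fun j => ?_
  split_ifs
  exacts [hB j, (hB j).compl]

open Classical in
theorem exists_mem_boolAtom {J X : Type*} (B : J → Set X) (x : X) :
    ∃ σ, x ∈ boolAtom B σ :=
  ⟨fun j => decide (x ∈ B j), fun j => by simp⟩

/-- The entropy of the partition into atoms of `B` is at most the sum of the entropies of the
two-set partitions `{B j, (B j)ᶜ}`. -/
theorem sum_negMulLog_boolAtom_le {J X : Type*} [Fintype J] [DecidableEq J] [MeasurableSpace X]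
    (μ : MeasureTheory.Measure X) [MeasureTheory.IsProbabilityMeasure μ] {B : J → Set X}
    (hB : ∀ j, MeasurableSet (B j)) :
    ∑ σ, Real.negMulLog (μ.real (boolAtom B σ)) ≤ ∑ j, Real.binEntropy (μ.real (B j)) := by
  set p : (J → Bool) → ℝ := fun σ => μ.real (boolAtom B σ)
  set b : J → Bool → ℝ := fun j v => if v = true then μ.real (B j) else 1 - μ.real (B j) with hb
  have hp0 : ∀ σ, 0 ≤ p σ := fun σ => MeasureTheory.measureReal_nonneg
  have hsum (S : Finset (J → Bool)) : ∑ σ ∈ S, p σ = μ.real (⋃ σ ∈ S, boolAtom B σ) :=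
    (MeasureTheory.measureReal_biUnion_finset (boolAtom_pairwiseDisjoint B _)
      fun σ _ => measurableSet_boolAtom hB σ).symm
  have hmarg (j : J) (v : Bool) : ∑ σ with σ j = v, p σ = b j v := by
    rw [hsum]
    cases v
    · have : ⋃ σ ∈ Finset.univ.filter (fun σ : J → Bool => σ j = false), boolAtom B σ
          = (B j)ᶜ := by
        ext x
        simp only [Set.mem_iUnion, Finset.mem_filter, Finset.mem_univ, true_and, Set.mem_compl_iff]
        constructor
        · rintro ⟨σ, hσ, hx⟩
          rw [hx j, hσ]
          simp
        · intro hx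
          obtain ⟨σ, hσ⟩ := exists_mem_boolAtom B x
          refine ⟨σ, ?_, hσ⟩
          rw [hσ j] at hx
          simpa using hx
      rw [this, MeasureTheory.probReal_compl_eq_one_sub (hB j)]
      simp [hb]
    · have : ⋃ σ ∈ Finset.univ.filter (fun σ : J → Bool => σ j = true), boolAtom B σ = B j := by
        ext x
        simp only [Set.mem_iUnion, Finset.mem_filter, Finset.mem_univ, true_and]
        constructor
        · rintro ⟨σ, hσ, hx⟩
          rwa [hx j]
        · intro hx
          obtain ⟨σ, hσ⟩ := exists_mem_boolAtom B x
          exact ⟨σ, (hσ j).1 hx, hσ⟩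
      rw [this]
      simp [hb]
  have hb0 (j : J) (v : Bool) : 0 ≤ b j v := by
    rw [← hmarg]
    exact Finset.sum_nonneg fun σ _ => hp0 σ
  have hple (σ : J → Bool) (j : J) : p σ ≤ b j (σ j) := by
    rw [← hmarg]
    exact Finset.single_le_sum (fun τ _ => hp0 τ) (by simp)
  have hbne (σ : J → Bool) (hσ : p σ ≠ 0) (j : J) : b j (σ j) ≠ 0 :=
    (lt_of_lt_of_le (lt_of_le_of_ne (hp0 σ) hσ.symm) (hple σ j)).ne'
  have hptot : ∑ σ, p σ = 1 := by
    rw [hsum]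
    have : ⋃ σ ∈ (Finset.univ : Finset (J → Bool)), boolAtom B σ = Set.univ := by
      ext x
      simpa using exists_mem_boolAtom B x
    rw [this, MeasureTheory.probReal_univ]
  have hqtot : ∑ σ : J → Bool, ∏ j, b j (σ j) = 1 := by
    have h := Finset.prod_univ_sum (fun _ : J => (Finset.univ : Finset Bool)) b
    rw [Fintype.piFinset_univ] at h
    rw [← h]
    exact Finset.prod_eq_one fun j _ => by simp [hb]
  calc ∑ σ, Real.negMulLog (p σ)
      ≤ ∑ σ, (-(p σ * Real.log (∏ j, b j (σ j))) + ∏ j, b j (σ j) - p σ) :=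
        Finset.sum_le_sum fun σ _ => negMulLog_le_neg_mul_log_add_sub (hp0 σ)
          (Finset.prod_nonneg fun j _ => hb0 _ _)
          fun hσ => Finset.prod_ne_zero_iff.2 fun j _ => hbne σ hσ j
    _ = ∑ σ, -(p σ * Real.log (∏ j, b j (σ j))) := by
        rw [Finset.sum_sub_distrib, Finset.sum_add_distrib, hqtot, hptot]
        ring
    _ = ∑ σ, ∑ j, -(p σ * Real.log (b j (σ j))) := by
        refine Finset.sum_congr rfl fun σ _ => ?_
        rw [Finset.sum_neg_distrib, ← Finset.mul_sum]
        by_cases hσ : p σ = 0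
        · simp [hσ]
        · rw [Real.log_prod fun j _ => hbne σ hσ j]
    _ = ∑ j, ∑ σ, -(p σ * Real.log (b j (σ j))) := Finset.sum_comm
    _ = ∑ j, Real.binEntropy (μ.real (B j)) := by
        refine Finset.sum_congr rfl fun j _ => ?_
        rw [← Finset.sum_fiberwise _ (fun σ : J → Bool => σ j)]
        have (v : Bool) : ∑ σ with σ j = v, -(p σ * Real.log (b j (σ j)))
            = Real.negMulLog (b j v) := by
          rw [Real.negMulLog, neg_mul, ← hmarg j v, Finset.sum_mul, ← Finset.sum_neg_distrib]
          refine Finset.sum_congr rfl fun σ hσ => ?_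
          rw [(Finset.mem_filter.1 hσ).2, hmarg]
        rw [Fintype.sum_bool, this, this, Real.binEntropy_eq_negMulLog_add_negMulLog_one_sub]
        simp [hb]

/-- If membership in the disjoint sets of `coll` is determined by membership in the sets `B j`,
then the entropy of `coll` is at most the sum of the entropies of the partitions `{B j, (B j)ᶜ}`. -/
theorem partitionShannonEntropy_le_sum_binEntropy {J X : Type*} [Fintype J] [MeasurableSpace X]
    (μ : MeasureTheory.Measure X) [MeasureTheory.IsProbabilityMeasure μ] {B : J → Set X}
    (hB : ∀ j, MeasurableSet (B j)) (coll : Finset (Set X))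
    (hdisj : (coll : Set (Set X)).PairwiseDisjoint id)
    (hsat : ∀ x y, (∀ j, x ∈ B j ↔ y ∈ B j) → ∀ Q ∈ coll, x ∈ Q → y ∈ Q) :
    partitionShannonEntropy μ coll ≤ ∑ j, Real.binEntropy (μ.real (B j)) := by
  classical
  refine le_trans ?_ (sum_negMulLog_boolAtom_le μ hB)
  let S : Set X → Finset (J → Bool) := fun Q => {σ | (boolAtom B σ ∩ Q).Nonempty}
  have hsub : ∀ Q ∈ coll, ∀ σ ∈ S Q, boolAtom B σ ⊆ Q := by
    intro Q hQ σ hσ y hy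
    obtain ⟨x, hx, hxQ⟩ := (Finset.mem_filter.1 hσ).2
    exact hsat x y (fun j => (hx j).trans (hy j).symm) Q hQ hxQ
  have hunion : ∀ Q ∈ coll, Q = ⋃ σ ∈ S Q, boolAtom B σ := by
    intro Q hQ
    refine Set.Subset.antisymm (fun x hx => ?_) (Set.iUnion₂_subset (hsub Q hQ))
    obtain ⟨σ, hσ⟩ := exists_mem_boolAtom B x
    exact Set.mem_iUnion₂.2 ⟨σ, Finset.mem_filter.2 ⟨Finset.mem_univ _, x, hσ, hx⟩, hσ⟩
  have hSdisj : (coll : Set (Set X)).PairwiseDisjoint S := by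
    intro Q hQ R hR hQR
    refine Finset.disjoint_left.2 fun σ hσ hσ' => ?_
    obtain ⟨x, hx, hxQ⟩ := (Finset.mem_filter.1 hσ).2
    exact Set.disjoint_left.1 (hdisj hQ hR hQR) hxQ (hsub R hR σ hσ' hx)
  have hnn (σ : J → Bool) : 0 ≤ Real.negMulLog (μ.real (boolAtom B σ)) :=
    Real.negMulLog_nonneg MeasureTheory.measureReal_nonneg MeasureTheory.measureReal_le_one
  calc partitionShannonEntropy μ coll
      ≤ ∑ Q ∈ coll, ∑ σ ∈ S Q, Real.negMulLog (μ.real (boolAtom B σ)) := by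
        refine Finset.sum_le_sum fun Q hQ => ?_
        change Real.negMulLog (μ.real Q) ≤ _
        conv_lhs => rw [hunion Q hQ]
        rw [MeasureTheory.measureReal_biUnion_finset (boolAtom_pairwiseDisjoint B _)
          fun σ _ => measurableSet_boolAtom hB σ]
        exact negMulLog_sum_le _ _ fun σ _ => MeasureTheory.measureReal_nonneg
    _ = ∑ σ ∈ coll.biUnion S, Real.negMulLog (μ.real (boolAtom B σ)) :=
        (Finset.sum_biUnion hSdisj).symm
    _ ≤ ∑ σ, Real.negMulLog (μ.real (boolAtom B σ)) :=
        Finset.sum_le_sum_of_subset_of_nonneg (Finset.subset_univ _) fun σ _ _ => hnn σ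

theorem mem_jointPartition {Γ X : Type*} [Group Γ] [MulAction Γ X] {F : Finset Γ}
    {partn : Finset (Set X)} {Q : Set X} (hQ : Q ∈ jointPartition F partn) :
    ∃ ω : ∀ s ∈ F, Set X, (∀ s h, ω s h ∈ partn) ∧ ∀ x, x ∈ Q ↔ ∀ s h, s • x ∈ ω s h := by
  classical
  simp only [jointPartition, Finset.mem_image, Finset.mem_pi] at hQ
  obtain ⟨ω, hω, rfl⟩ := hQ
  exact ⟨ω, hω, fun x => by simp⟩

theorem jointPartition_pairwiseDisjoint {Γ X : Type*} [Group Γ] [MeasurableSpace X]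
    [MulAction Γ X] (F : Finset Γ) {partn : Finset (Set X)} (hP : IsFinBorelPartition partn) :
    (jointPartition F partn : Set (Set X)).PairwiseDisjoint id := by
  intro Q hQ R hR hQR
  obtain ⟨ω, hω, hQm⟩ := mem_jointPartition hQ
  obtain ⟨ω', hω', hRm⟩ := mem_jointPartition hR
  refine Set.disjoint_left.2 fun x hx hx' => hQR (Set.ext fun y => ?_)
  have hωω' : ω = ω' := by
    funext s h
    by_contra hne
    exact Set.disjoint_left.1 (hP.2.2 _ (hω s h) _ (hω' s h) hne) ((hQm x).1 hx s h)
      ((hRm x).1 hx' s h)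
  rw [hQm, hRm, hωω']

open scoped Pointwise in
/-- In an infinite group every finite set `F` has arbitrarily many pairwise disjoint right
translates. -/
theorem exists_card_mul_eq {Γ : Type*} [Group Γ] [Infinite Γ] [DecidableEq Γ] (F : Finset Γ)
    (m : ℕ) : ∃ K : Finset Γ, K.card = m ∧ (F * K).card = F.card * m := by
  induction m with
  | zero => exact ⟨∅, by simp⟩
  | succ m ih =>
    obtain ⟨K, hK, hFK⟩ := ih
    obtain ⟨g, hg⟩ := Infinite.exists_notMem_finset (F⁻¹ * (F * K) ∪ K)
    rw [Finset.mem_union, not_or] at hg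
    refine ⟨insert g K, by rw [Finset.card_insert_of_notMem hg.2, hK], ?_⟩
    rw [Finset.insert_eq, Finset.mul_union, Finset.card_union_of_disjoint, hFK]
    · rw [Finset.card_mul_singleton]
      ring
    · refine Finset.disjoint_left.2 fun x hx hx' => hg.1 ?_
      obtain ⟨f, hf, g', hg', rfl⟩ := Finset.mem_mul.1 hx
      rw [Finset.mem_singleton] at hg'
      subst hg'
      exact Finset.mem_mul.2 ⟨f⁻¹, Finset.inv_mem_inv hf, _, hx', by group⟩

open scoped Pointwise in
/-- In an infinite group there are finite sets of prescribed growth, each of which tiles all the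
later ones. -/
theorem exists_tiling_sequence {Γ : Type*} [Group Γ] [Infinite Γ] [DecidableEq Γ]
    (M : ℕ → ℕ) (hM : ∀ n, 0 < M n) :
    ∃ F : ℕ → Finset Γ, (∀ n, M n ≤ (F n).card) ∧
      ∀ n, ∀ i ≤ n, ∃ T, F n = F i * T ∧ (F i).card * T.card ≤ (F n).card := by
  choose K hK hFK using fun (F : Finset Γ) (m : ℕ) => exists_card_mul_eq F m
  obtain ⟨F₀, hF₀⟩ := Infinite.exists_subset_card_eq Γ (M 0)
  let F : ℕ → Finset Γ := fun n => Nat.rec F₀ (fun n A => A * K A (M (n + 1))) n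
  have hF (n : ℕ) : F (n + 1) = F n * K (F n) (M (n + 1)) := rfl
  have hcard (n : ℕ) : M n ≤ (F n).card := by
    induction n with
    | zero => exact hF₀.ge
    | succ n ih =>
      rw [hF, hFK]
      exact Nat.le_mul_of_pos_left _ ((hM n).trans_le ih)
  refine ⟨F, hcard, fun n i hi => ?_⟩
  induction n, hi using Nat.le_induction with
  | base => exact ⟨1, by simp⟩
  | succ n _ ih =>
    obtain ⟨T, hT, hTc⟩ := ih
    refine ⟨T * K (F n) (M (n + 1)), ?_, ?_⟩
    · rw [hF, ← mul_assoc, ← hT]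
    · calc (F i).card * (T * K (F n) (M (n + 1))).card
          ≤ (F i).card * (T.card * M (n + 1)) := by
            gcongr
            exact Finset.card_mul_le.trans_eq (by rw [hK])
        _ = (F i).card * T.card * M (n + 1) := by ring
        _ ≤ (F n).card * M (n + 1) := by gcongr
        _ = (F (n + 1)).card := by rw [hF, hFK]

theorem exists_le_entropy_of_naiveMeasureEntropy_ne_zero {Γ X : Type*} [Group Γ]
    [MeasurableSpace X] [MulAction Γ X] {μ : MeasureTheory.Measure X}
    (h : naiveMeasureEntropy Γ μ ≠ 0) :
    ∃ (partn : Finset (Set X)) (c : ℝ), IsFinBorelPartition partn ∧ 0 < c ∧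
      ∀ F : Finset Γ, F.Nonempty →
        c * F.card ≤ partitionShannonEntropy μ (jointPartition F partn) := by
  obtain ⟨⟨partn, hP⟩, hne⟩ : ∃ partn : {partn : Finset (Set X) // IsFinBorelPartition partn},
      (⨅ F : {F : Finset Γ // F.Nonempty}, ENNReal.ofReal
        (partitionShannonEntropy μ (jointPartition F.1 partn.1) / (F.1.card : ℝ))) ≠ 0 := by
    by_contra! hall
    exact h (by simp [naiveMeasureEntropy, hall])
  set r := ⨅ F : {F : Finset Γ // F.Nonempty}, ENNReal.ofReal
        (partitionShannonEntropy μ (jointPartition F.1 partn) / (F.1.card : ℝ))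
  have hle (F : Finset Γ) (hF : F.Nonempty) :
      r ≤ ENNReal.ofReal (partitionShannonEntropy μ (jointPartition F partn) / (F.card : ℝ)) :=
    iInf_le (fun F : {F : Finset Γ // F.Nonempty} => ENNReal.ofReal
        (partitionShannonEntropy μ (jointPartition F.1 partn) / (F.1.card : ℝ))) ⟨F, hF⟩
  have hfin : r ≠ ⊤ :=
    ((hle {1} (Finset.singleton_nonempty _)).trans_lt ENNReal.ofReal_lt_top).ne
  have hpos : 0 < r.toReal := ENNReal.toReal_pos hne hfin
  refine ⟨partn, r.toReal, hP, hpos, fun F hF => ?_⟩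
  rw [← le_div_iff₀ (by exact_mod_cast hF.card_pos)]
  have h1 := hle F hF
  rw [← ENNReal.ofReal_toReal hfin] at h1
  exact (ENNReal.ofReal_le_ofReal_iff' .. |>.1 h1).resolve_right (not_le.2 hpos)

theorem exists_isCompact_binEntropy_diff_le {X : Type*} [MetricSpace X] [CompactSpace X]
    [MeasurableSpace X] [BorelSpace X] (μ : MeasureTheory.Measure X)
    [MeasureTheory.IsProbabilityMeasure μ] {A : Set X} (hA : MeasurableSet A) {δ : ℝ}
    (hδ : 0 < δ) : ∃ C ⊆ A, IsCompact C ∧ Real.binEntropy (μ.real (A \ C)) ≤ δ := by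
  have hcont := Real.binEntropy_continuous.tendsto 0
  rw [Real.binEntropy_zero] at hcont
  obtain ⟨η, hη, hball⟩ := Metric.eventually_nhds_iff.1 (hcont.eventually (Iic_mem_nhds hδ))
  obtain ⟨C, hCA, hC, hμ⟩ := hA.exists_isCompact_sdiff_lt (MeasureTheory.measure_ne_top μ A)
    (ENNReal.ofReal_pos.2 hη).ne'
  refine ⟨C, hCA, hC, hball ?_⟩
  rw [Real.dist_0_eq_abs, abs_of_nonneg MeasureTheory.measureReal_nonneg,
    MeasureTheory.measureReal_def]
  exact (ENNReal.lt_ofReal_iff_toReal_lt (MeasureTheory.measure_ne_top _ _)).1 hμ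

/-- If the entropy of `partn` along `F` exceeds the entropy carried by the sets `B j` observed
along finite sets `T j`, then two points that these observations cannot tell apart are separated
by `partn` at some element of `F`. -/
theorem exists_separated_of_sum_binEntropy_lt {Γ X J : Type*} [Group Γ] [MeasurableSpace X]
    [MulAction Γ X] [MeasurableConstSMul Γ X] [Fintype J] {μ : MeasureTheory.Measure X}
    [MeasureTheory.IsProbabilityMeasure μ]
    (hinv : ∀ (s : Γ) (A : Set X), MeasurableSet A → μ ((fun x : X => s • x) ⁻¹' A) = μ A)
    {partn : Finset (Set X)} (hP : IsFinBorelPartition partn) (F : Finset Γ)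
    {B : J → Set X} (hB : ∀ j, MeasurableSet (B j)) (T : J → Finset Γ)
    (hlt : ∑ j, (T j).card * Real.binEntropy (μ.real (B j)) <
      partitionShannonEntropy μ (jointPartition F partn)) :
    ∃ x y : X, (∀ j, ∀ t ∈ T j, t • x ∈ B j ↔ t • y ∈ B j) ∧
      ∃ f ∈ F, ∃ A ∈ partn, f • x ∈ A ∧ f • y ∉ A := by
  by_contra! hcon
  refine hlt.not_ge ?_
  let B' : (Σ j, T j) → Set X := fun p => (fun x : X => (p.2 : Γ) • x) ⁻¹' B p.1
  refine (partitionShannonEntropy_le_sum_binEntropy μ (B := B')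
    (fun p => measurable_const_smul (p.2 : Γ) (hB p.1)) _
    (jointPartition_pairwiseDisjoint F hP) ?_).trans_eq ?_
  · intro x y hxy Q hQ hx
    obtain ⟨ω, hω, hQm⟩ := mem_jointPartition hQ
    rw [hQm] at hx ⊢
    exact fun s h => hcon x y (fun j t ht => hxy ⟨j, t, ht⟩) s h _ (hω s h) (hx s h)
  · have (p : Σ j, T j) : μ.real (B' p) = μ.real (B p.1) := by
      simp only [MeasureTheory.measureReal_def, B', hinv _ _ (hB p.1)]
    simp [this, Fintype.sum_sigma]

open scoped Pointwise in
/-- Positive naive measure entropy produces a proximal pair of distinct points. -/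
theorem exists_proximal_pair {Γ X : Type*} [Group Γ] [Infinite Γ] [MetricSpace X] [CompactSpace X]
    [MeasurableSpace X] [BorelSpace X] [MulAction Γ X] [ContinuousConstSMul Γ X]
    {μ : MeasureTheory.Measure X} [MeasureTheory.IsProbabilityMeasure μ]
    (hinv : ∀ (s : Γ) (A : Set X), MeasurableSet A → μ ((fun x : X => s • x) ⁻¹' A) = μ A)
    {partn : Finset (Set X)} (hP : IsFinBorelPartition partn) {c : ℝ} (hc : 0 < c)
    (hent : ∀ F : Finset Γ, F.Nonempty →
      c * F.card ≤ partitionShannonEntropy μ (jointPartition F partn)) :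
    ∃ z w : X, z ≠ w ∧ ∀ ε > 0, ∃ s : Γ, dist (s • z) (s • w) < ε := by
  classical
  -- Compact approximations of the pieces of the partition.
  obtain ⟨δ, hδ, hδc⟩ : ∃ δ : ℝ, 0 < δ ∧ partn.card * δ ≤ c / 4 := by
    refine ⟨c / 4 / (partn.card + 1), by positivity, ?_⟩
    rw [mul_div_assoc', div_le_iff₀ (by positivity)]
    nlinarith
  choose! C hCA hCc hCδ using
    fun (A : Set X) (hA : A ∈ partn) => exists_isCompact_binEntropy_diff_le μ (hP.1 A hA) hδ
  -- Finite covers by small balls.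
  choose t _ htfin htcov using fun n : ℕ =>
    finite_cover_balls_of_compact (isCompact_univ (X := X))
      (Nat.one_div_pos_of_nat (α := ℝ) (n := n))
  let t' : ℕ → Finset X := fun n => (htfin n).toFinset
  -- The growth rate beats the entropy of the covers.
  have hgrow (n : ℕ) : ∃ m : ℕ, 0 < m ∧ (t' n).card * Real.log 2 ≤ c / 4 * (1 / 2) ^ n * m := by
    obtain ⟨m, hm⟩ := exists_nat_ge ((t' n).card * Real.log 2 / (c / 4 * (1 / 2) ^ n))
    refine ⟨m + 1, m.succ_pos, ?_⟩
    rw [div_le_iff₀ (by positivity)] at hm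
    push_cast
    nlinarith [show 0 < c / 4 * (1 / 2) ^ n by positivity]
  choose M hM hMt using hgrow
  obtain ⟨F, hFM, hFT⟩ := exists_tiling_sequence (Γ := Γ) M hM
  -- Closed sets of pairs which are separated, but come close along elements of `(F i)⁻¹`.
  let D : Set (X × X) := ⋃ p ∈ partn.offDiag, C p.1 ×ˢ C p.2
  let E : ℕ → Set (X × X) := fun n =>
    D ∩ ⋂ i ∈ Finset.range (n + 1), ⋃ a ∈ F i,
      {p | dist (a⁻¹ • p.1) (a⁻¹ • p.2) ≤ 2 * (1 / (i + 1))}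
  have hDc : IsCompact D := by
    refine partn.offDiag.isCompact_biUnion fun p hp => ?_
    rw [Finset.mem_offDiag] at hp
    exact (hCc _ hp.1).prod (hCc _ hp.2.1)
  have hDne : ∀ p ∈ D, p.1 ≠ p.2 := by
    intro p hp hpp
    obtain ⟨q, hq, hz⟩ := Set.mem_iUnion₂.1 hp
    rw [Finset.mem_offDiag] at hq
    exact Set.disjoint_left.1 (hP.2.2 _ hq.1 _ hq.2.1 hq.2.2) (hCA _ hq.1 hz.1)
      (hpp ▸ hCA _ hq.2.1 hz.2)
  have hEcl (n : ℕ) : IsClosed (E n) := by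
    refine hDc.isClosed.inter (isClosed_biInter fun i _ => ?_)
    refine (F i).finite_toSet.isClosed_biUnion fun a _ => ?_
    exact isClosed_le (by fun_prop) continuous_const
  have hEne (n : ℕ) : (E n).Nonempty := by
    choose T hT hTc using fun i : Fin (n + 1) => hFT n i (Nat.lt_succ_iff.1 i.2)
    have hFpos (i : ℕ) : 0 < ((F i).card : ℝ) := by exact_mod_cast (hM i).trans_le (hFM i)
    have hFne : (F n).Nonempty := Finset.card_pos.1 ((hM n).trans_le (hFM n))
    let B : partn ⊕ (Σ i : Fin (n + 1), t' i) → Set X :=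
      Sum.elim (fun A => A.1 \ C A.1) fun q => Metric.ball q.2.1 (1 / ((q.1 : ℕ) + 1))
    have hB : ∀ j, MeasurableSet (B j) := by
      rintro (A | q)
      · exact (hP.1 _ A.2).diff (hCc _ A.2).measurableSet
      · exact measurableSet_ball
    have hcover (i : Fin (n + 1)) : (T i).card * ((t' i).card * Real.log 2) ≤
        (F n).card * (c / 4 * (1 / 2) ^ (i : ℕ)) := by
      have h1 : ((F i).card : ℝ) * (T i).card ≤ (F n).card := by exact_mod_cast hTc i
      have h2 : (M i : ℝ) ≤ (F i).card := by exact_mod_cast hFM i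
      calc ((T i).card : ℝ) * ((t' i).card * Real.log 2)
          ≤ (T i).card * (c / 4 * (1 / 2) ^ (i : ℕ) * (F i).card) := by
            refine mul_le_mul_of_nonneg_left ((hMt i).trans ?_) (Nat.cast_nonneg _)
            gcongr
        _ = (F i).card * (T i).card * (c / 4 * (1 / 2) ^ (i : ℕ)) := by ring
        _ ≤ _ := by gcongr
    obtain ⟨x, y, hxy, f, hf, A, hA, hxA, hyA⟩ := exists_separated_of_sum_binEntropy_lt hinv hP (F n)
      hB (Sum.elim (fun _ => F n) fun q => T q.1) <| by
      refine lt_of_lt_of_le ?_ (hent (F n) hFne)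
      rw [Fintype.sum_sum_type, Fintype.sum_sigma]
      calc _ ≤ (∑ _A : partn, ((F n).card : ℝ) * δ) +
            ∑ i : Fin (n + 1), ∑ _q : t' i, ((T i).card : ℝ) * Real.log 2 := by
            refine add_le_add (Finset.sum_le_sum fun A _ => ?_)
              (Finset.sum_le_sum fun i _ => Finset.sum_le_sum fun q _ => ?_)
            · exact mul_le_mul_of_nonneg_left (hCδ _ A.2) (Nat.cast_nonneg _)
            · exact mul_le_mul_of_nonneg_left Real.binEntropy_le_log_two (Nat.cast_nonneg _)
        _ = (F n).card * (partn.card * δ) +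
            ∑ i : Fin (n + 1), (T i).card * ((t' i).card * Real.log 2) := by
            simp only [Finset.sum_const, Finset.card_univ, Fintype.card_coe, nsmul_eq_mul]
            congr 1
            · ring
            · exact Finset.sum_congr rfl fun i _ => by ring
        _ ≤ (F n).card * (c / 4) + ∑ i : Fin (n + 1), (F n).card * (c / 4 * (1 / 2) ^ (i : ℕ)) := by
            exact add_le_add (mul_le_mul_of_nonneg_left hδc (Nat.cast_nonneg _))
              (Finset.sum_le_sum fun i _ => hcover i)
        _ = (F n).card * (c / 4) + (F n).card * (c / 4 * ∑ i ∈ Finset.range (n + 1), (1 / 2) ^ i) := by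
            rw [← Finset.mul_sum, ← Finset.mul_sum,
              Fin.sum_univ_eq_sum_range fun i => (1 / 2 : ℝ) ^ i]
        _ ≤ (F n).card * (c / 4) + (F n).card * (c / 4 * 2) := by
            gcongr
            exact sum_geometric_two_le _
        _ < c * (F n).card := by nlinarith [mul_pos hc (hFpos n)]
    obtain ⟨A', hA', hyA'⟩ : ∃ A' ∈ partn, f • y ∈ A' := by
      have : f • y ∈ ⋃₀ (partn : Set (Set X)) := hP.2.1 ▸ Set.mem_univ _
      exact this
    have hAA' : A ≠ A' := by
      rintro rfl
      exact hyA hyA'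
    have hxA' : f • x ∉ A' := Set.disjoint_left.1 (hP.2.2 _ hA _ hA' hAA') hxA
    refine ⟨(f • x, f • y), Set.mem_iUnion₂.2 ⟨(A, A'),
      Finset.mem_offDiag.2 ⟨hA, hA', hAA'⟩, ?_, ?_⟩,
      Set.mem_iInter₂.2 fun i hi => ?_⟩
    · by_contra hxC
      exact hyA ((hxy (.inl ⟨A, hA⟩) f hf).1 ⟨hxA, hxC⟩).1
    · by_contra hyC
      exact hxA' ((hxy (.inl ⟨A', hA'⟩) f hf).2 ⟨hyA', hyC⟩).1
    · let k : Fin (n + 1) := ⟨i, Finset.mem_range.1 hi⟩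
      have hf' := hf
      rw [hT k] at hf'
      obtain ⟨a, ha, s, hs, rfl⟩ := Finset.mem_mul.1 hf'
      refine Set.mem_iUnion₂.2 ⟨a, ha, ?_⟩
      obtain ⟨u, hu, hxu⟩ := Set.mem_iUnion₂.1 (htcov i (Set.mem_univ (s • x)))
      have hyu := (hxy (.inr ⟨k, ⟨u, (htfin i).mem_toFinset.2 hu⟩⟩) s hs).1 hxu
      change s • y ∈ Metric.ball u (1 / ((i : ℝ) + 1)) at hyu
      change dist (a⁻¹ • (a * s) • x) (a⁻¹ • (a * s) • y) ≤ _
      rw [mul_smul, mul_smul, inv_smul_smul, inv_smul_smul]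
      linarith [dist_triangle_right (s • x) (s • y) u, Metric.mem_ball.1 hxu, Metric.mem_ball.1 hyu]
  obtain ⟨⟨z, w⟩, hzw⟩ := IsCompact.nonempty_iInter_of_sequence_nonempty_isCompact_isClosed E
    (fun n => Set.inter_subset_inter_right _ (Set.biInter_subset_biInter_left fun i hi =>
      Finset.mem_range.2 ((Finset.mem_range.1 hi).trans (Nat.lt_succ_self _))))
    hEne (hDc.of_isClosed_subset (hEcl 0) Set.inter_subset_left) hEcl
  rw [Set.mem_iInter] at hzw
  refine ⟨z, w, hDne _ (hzw 0).1, fun ε hε => ?_⟩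
  obtain ⟨n, hn⟩ := exists_nat_one_div_lt (half_pos hε)
  obtain ⟨a, _, ha⟩ := Set.mem_iUnion₂.1
    (Set.mem_iInter₂.1 (hzw n).2 n (Finset.self_mem_range_succ n))
  refine ⟨a⁻¹, lt_of_le_of_lt ha ?_⟩
  linarith

/-- If a countably infinite group `Γ` acts distally by homeomorphisms on a compact
metrizable space `X` and `μ` is a `Γ`-invariant Borel probability measure on `X`, then
the naive measure entropy `h^nv_μ(Γ ↷ X)` is zero. -/
theorem distal_implies_zero_naive_measure_entropy
    {Γ : Type*} [Group Γ] [Countable Γ] [Infinite Γ]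
    {X : Type*} [MetricSpace X] [CompactSpace X]
    [MeasurableSpace X] [BorelSpace X]
    [MulAction Γ X] [ContinuousConstSMul Γ X]
    (hdistal : ∀ x y : X, x ≠ y → ∃ c : ℝ, 0 < c ∧ ∀ s : Γ, c ≤ dist (s • x) (s • y))
    (μ : MeasureTheory.Measure X) [MeasureTheory.IsProbabilityMeasure μ]
    (hinv : ∀ (s : Γ) (A : Set X), MeasurableSet A → μ ((fun x : X => s • x) ⁻¹' A) = μ A) :
    naiveMeasureEntropy Γ μ = 0 := by
  by_contra hne
  obtain ⟨partn, c, hP, hc, hent⟩ := exists_le_entropy_of_naiveMeasureEntropy_ne_zero hne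
  obtain ⟨z, w, hzw, hprox⟩ := exists_proximal_pair hinv hP hc hent
  obtain ⟨ε, hε, hle⟩ := hdistal z w hzw
  obtain ⟨s, hs⟩ := hprox ε hε
  exact (hle s).not_gt hs
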